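/- Let k ≥ 1 and r ≥ 3 be integers. Let G be a graph and let L_1,…,L_{r−1} be pairwise disjoint subsets of V(G) such that for every i and every vertex x ∈ L_i, fewer than k^2 r^2 vertices of V(G) ∖ L_i are non-adjacent to x. Let P ⊆ V(G) with |P| ≤ kr, and let K be a clique of G with K ∩ P = ∅ which contains exactly one vertex f with f ∉ L_1 ∪ … ∪ L_{r−1} and at most one vertex from each L_i, and suppose that for every i with K ∩ L_i = ∅ the vertex f has at least k^2 r^3 neighbors in L_i. Then G contains a clique C on r vertices with K ⊆ C such that C ∖ {f} contains exactly one vertex from each of the sets L_1 ∖ P, …, L_{r−1} ∖ P. -/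

import Mathlib

open SimpleGraph Finset

/-- A clique that contains `f`, lies in `{f} ∪ ⋃ i, L i`, has at most one vertex in each `L i`
and misses `L i` can be extended, while avoiding `P`, by a vertex of `L i`, provided that `f` has
many neighbors in `L i` and that vertices in `⋃ j, L j` have few non-neighbors outside their
own part. -/
theorem exists_mem_isClique_insert {V ι : Type*} [Finite V] [Fintype ι] (G : SimpleGraph V)
    (L : ι → Set V) (hdisj : ∀ i j, i ≠ j → Disjoint (L i) (L j)) (m : ℕ)
    (hsee : ∀ i, ∀ x ∈ L i, ({y | y ∉ L i ∧ y ≠ x ∧ ¬ G.Adj x y}).ncard ≤ m)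
    (P C : Set V) (hC : G.IsClique C) (f : V) (hf : ∀ x ∈ C, x ∉ ⋃ i, L i → x = f)
    (hone : ∀ i, (C ∩ L i).Subsingleton) (i : ι) (hi : C ∩ L i = ∅)
    (hdeg : P.ncard + Fintype.card ι * m < (G.neighborSet f ∩ L i).ncard) :
    ∃ y ∈ L i, y ∉ P ∧ G.IsClique (insert y C) := by
  set B : ι → Set V := fun j => {y | y ∈ L i ∧ ∃ x ∈ C ∩ L j, ¬ G.Adj x y} with hB
  have hBcard : ∀ j, (B j).ncard ≤ m := by
    intro j
    rcases (C ∩ L j).eq_empty_or_nonempty with he | ⟨x, hx⟩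
    · have : B j = ∅ := by simp only [hB, he]; simp
      simp [this]
    · refine (Set.ncard_le_ncard ?_ (Set.toFinite _)).trans (hsee j x hx.2)
      rintro y ⟨hyi, z, hz, hzy⟩
      obtain rfl := hone j hx hz
      have hij : i ≠ j := by
        rintro rfl
        exact (hi ▸ hx : x ∈ (∅ : Set V))
      have hyj : y ∉ L j := Set.disjoint_left.1 (hdisj i j hij) hyi
      exact ⟨hyj, fun h => hyj (h ▸ hx.2), hzy⟩
  have hlt : (P ∪ ⋃ j, B j).ncard < (G.neighborSet f ∩ L i).ncard := by
    refine lt_of_le_of_lt ?_ hdeg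
    refine (Set.ncard_union_le _ _).trans (Nat.add_le_add_left ?_ _)
    refine (Set.ncard_iUnion_le_of_fintype B).trans ?_
    simpa using Finset.sum_le_card_nsmul Finset.univ (fun j => (B j).ncard) m
      (fun j _ => hBcard j)
  obtain ⟨y, ⟨hyf, hyi⟩, hy⟩ := Set.exists_mem_notMem_of_ncard_lt_ncard hlt (Set.toFinite _)
  refine ⟨y, hyi, fun h => hy (Or.inl h), hC.insert fun x hx _ => ?_⟩
  by_cases hxL : x ∈ ⋃ j, L j
  · obtain ⟨j, hj⟩ := Set.mem_iUnion.1 hxL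
    by_contra hadj
    exact hy (Or.inr (Set.mem_iUnion.2 ⟨j, hyi, x, ⟨hx, hj⟩, fun h => hadj h.symm⟩))
  · rw [hf x hx hxL]
    exact hyf.symm

/-- Proposition (P-avoiding extension): given pairwise disjoint sets `L₁,…,L_{r-1}` such
that every vertex of `Lᵢ` has fewer than `k²r²` non-neighbors outside `Lᵢ`, a set `P`
with `|P| ≤ kr`, and a clique `K` disjoint from `P` containing exactly one vertex `f`
outside `L₁ ∪ … ∪ L_{r-1}` and at most one vertex from each `Lᵢ`, with `f` having at
least `k²r³` neighbors in every `Lᵢ` missed by `K`, there is an `r`-clique `C ⊇ K`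
such that `C ∖ {f}` has exactly one vertex in each `Lᵢ ∖ P`. -/
theorem avoiding_extension {V : Type*} [Fintype V] (k r : ℕ) (hk : 1 ≤ k) (hr : 3 ≤ r)
    (G : SimpleGraph V) (L : Fin (r - 1) → Set V)
    (hdisj : ∀ i j, i ≠ j → Disjoint (L i) (L j))
    (hsee : ∀ i, ∀ x ∈ L i, ({y | y ∉ L i ∧ y ≠ x ∧ ¬ G.Adj x y}).ncard < k ^ 2 * r ^ 2)
    (P : Set V) (hP : P.ncard ≤ k * r)
    (K : Set V) (hK : G.IsClique K) (hKP : Disjoint K P)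
    (f : V) (hfK : f ∈ K) (hfL : f ∉ ⋃ i, L i)
    (hfuniq : ∀ x ∈ K, x ∉ ⋃ i, L i → x = f)
    (hone : ∀ i, (K ∩ L i).Subsingleton)
    (hdeg : ∀ i, K ∩ L i = ∅ → k ^ 2 * r ^ 3 ≤ (G.neighborSet f ∩ L i).ncard) :
    ∃ C : Set V, G.IsClique C ∧ C.ncard = r ∧ K ⊆ C ∧
      ∀ i, ∃! y, y ∈ (C \ {f}) ∩ (L i \ P) := by
  have hbound : P.ncard + Fintype.card (Fin (r - 1)) * (k ^ 2 * r ^ 2) < k ^ 2 * r ^ 3 := by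
    obtain ⟨s, rfl⟩ : ∃ s, r = s + 1 := ⟨r - 1, by omega⟩
    have h1 : 1 < k * (s + 1) := by nlinarith
    simp only [Fintype.card_fin, Nat.add_sub_cancel]
    nlinarith
  have key : ∀ S : Finset (Fin (r - 1)), ∃ C : Set V, G.IsClique C ∧ K ⊆ C ∧ Disjoint C P ∧
      (∀ x ∈ C, x ∉ ⋃ i, L i → x = f) ∧ (∀ i, (C ∩ L i).Subsingleton) ∧
      ∀ i ∈ S, (C ∩ L i).Nonempty := by
    classical
    intro S
    induction S using Finset.induction_on with
    | empty => exact ⟨K, hK, subset_rfl, hKP, hfuniq, hone, by simp⟩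
    | insert i S _ ih =>
      obtain ⟨C, hC, hKC, hCP, hCf, hC1, hCS⟩ := ih
      rcases (C ∩ L i).eq_empty_or_nonempty with he | hne
      · have hKi : K ∩ L i = ∅ :=
          Set.subset_empty_iff.1 (he ▸ Set.inter_subset_inter_left _ hKC)
        obtain ⟨y, hyi, hyP, hyC⟩ := exists_mem_isClique_insert G L hdisj (k ^ 2 * r ^ 2)
          (fun i x hx => (hsee i x hx).le) P C hC f hCf hC1 i he
          (hbound.trans_le (hdeg i hKi))
        refine ⟨insert y C, hyC, hKC.trans (Set.subset_insert _ _),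
          Set.disjoint_insert_left.2 ⟨hyP, hCP⟩, ?_, ?_, ?_⟩
        · rintro x (rfl | hx) hxL
          · exact absurd (Set.mem_iUnion.2 ⟨i, hyi⟩) hxL
          · exact hCf x hx hxL
        · intro j
          by_cases hij : i = j
          · subst hij
            rw [Set.insert_inter_of_mem hyi, he]
            simp
          · rw [Set.insert_inter_of_notMem (Set.disjoint_left.1 (hdisj i j hij) hyi)]
            exact hC1 j
        · intro j hj
          rcases Finset.mem_insert.1 hj with rfl | hj
          · exact ⟨y, Set.mem_insert _ _, hyi⟩
          · exact (hCS j hj).mono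
              (Set.inter_subset_inter_left _ (Set.subset_insert _ _))
      · refine ⟨C, hC, hKC, hCP, hCf, hC1, fun j hj => ?_⟩
        rcases Finset.mem_insert.1 hj with rfl | hj
        · exact hne
        · exact hCS j hj
  obtain ⟨C, hC, hKC, hCP, hCf, hC1, hCne⟩ := key Finset.univ
  choose g hg using fun i => hCne i (Finset.mem_univ i)
  have hgf : ∀ i, g i ≠ f := fun i h => hfL (Set.mem_iUnion.2 ⟨i, h ▸ (hg i).2⟩)
  have hginj : Function.Injective g := by
    intro i j hij
    by_contra hne
    exact Set.disjoint_left.1 (hdisj i j hne) (hg i).2 (hij ▸ (hg j).2)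
  have hCeq : C = insert f (Set.range g) := by
    ext x
    constructor
    · intro hx
      by_cases hxL : x ∈ ⋃ i, L i
      · obtain ⟨i, hi⟩ := Set.mem_iUnion.1 hxL
        exact Or.inr ⟨i, hC1 i (hg i) ⟨hx, hi⟩⟩
      · exact Or.inl (hCf x hx hxL)
    · rintro (rfl | ⟨i, rfl⟩)
      · exact hKC hfK
      · exact (hg i).1
  refine ⟨C, hC, ?_, hKC, fun i => ⟨g i, ?_, ?_⟩⟩
  · have hcard : (Set.range g).ncard = r - 1 := by
      rw [← Set.image_univ, Set.ncard_image_of_injective _ hginj, Set.ncard_univ, Nat.card_fin]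
    rw [hCeq, Set.ncard_insert_of_notMem (by rintro ⟨i, hi⟩; exact hgf i hi) (Set.toFinite _),
      hcard]
    omega
  · exact ⟨⟨(hg i).1, hgf i⟩, (hg i).2, Set.disjoint_left.1 hCP (hg i).1⟩
  · rintro y ⟨⟨hy, _⟩, hyi, _⟩
    exact hC1 i ⟨hy, hyi⟩ (hg i)
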